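/- Let X be a compact subset of C(ℝ, ℝ^ℕ) (compact-open topology) consisting of functions with values in [0,1]^ℕ, and suppose X is invariant under all shifts τ_r. Define G : X → (ℕ × ℕ → C(ℝ, ℝ)) by G(f)(n, i) = f_i ∗ φ_{n+1}, where f = (f_i)_{i ∈ ℕ} and (f_i ∗ φ_{n+1})(x) = ∫_ℝ f_i(x − t) φ_{n+1}(t) dt, and where the target carries the product of compact-open topologies. Then G is injective, continuous, a homeomorphism onto its image, and equivariant: G(τ_r f)(n, i) = τ_r(G(f)(n, i)) for all r ∈ ℝ, f ∈ X, and n, i ∈ ℕ. Moreover each component G(f)(n, i) satisfies |G(f)(n, i)(x)| ≤ 1 for all x ∈ ℝ and has distributional Fourier support contained in [-(n+1), n+1], i.e., for every Schwartz function g : ℝ → ℂ with support disjoint from [-(n+1), n+1], ∫_ℝ G(f)(n, i)(x) · (𝓕g)(x) dx = 0, where 𝓕g(ξ) = ∫_ℝ e^{-2πi x ξ} g(x) dx. -/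

import Mathlib

open MeasureTheory Real Topology

/-- The shift `τ_r` on the space `C(ℝ, E)` of continuous maps (compact-open topology):
`(τ_r f)(t) = f (t + r)`. -/
noncomputable def tau {E : Type*} [TopologicalSpace E] (r : ℝ) (f : C(ℝ, E)) : C(ℝ, E) :=
  f.comp ⟨fun t => t + r, continuous_add_right r⟩

/-- The Fejér kernel `φ_n(x) = sin²(πnx)/(nπ²x²)` (with `φ_n(0) = n`). -/
noncomputable def fejer (n : ℕ) (x : ℝ) : ℝ :=
  if x = 0 then (n : ℝ)
  else (Real.sin (Real.pi * n * x)) ^ 2 / (n * Real.pi ^ 2 * x ^ 2)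

/-- The Fourier transform `𝓕g(ξ) = ∫_ℝ e^{-2πixξ} g(x) dx`. -/
noncomputable def ftransform (g : ℝ → ℂ) (ξ : ℝ) : ℂ :=
  ∫ x : ℝ, Complex.exp ((-2) * Real.pi * Complex.I * x * ξ) * g x

open Filter FourierTransform

/-- The triangle function `ξ ↦ max 0 (1 - |ξ| / n)`, whose Fourier transform is `fejer n`. -/
noncomputable def triangle (n : ℕ) (ξ : ℝ) : ℝ := max 0 (1 - |ξ| / n)

lemma continuous_triangle (n : ℕ) : Continuous (triangle n) := by
  unfold triangle; fun_prop

lemma triangle_eq_zero {n : ℕ} (hn : 0 < n) {ξ : ℝ} (h : (n : ℝ) ≤ |ξ|) : triangle n ξ = 0 := by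
  have hn' : (0 : ℝ) < n := by exact_mod_cast hn
  have : 1 ≤ |ξ| / n := by rwa [le_div_iff₀ hn', one_mul]
  exact max_eq_left (by linarith)

lemma triangle_neg (n : ℕ) (ξ : ℝ) : triangle n (-ξ) = triangle n ξ := by
  simp [triangle]

lemma integrable_triangle {n : ℕ} (hn : 0 < n) : Integrable (triangle n) := by
  refine (continuous_triangle n).integrable_of_hasCompactSupport ?_
  refine HasCompactSupport.intro (isCompact_Icc (a := -(n : ℝ)) (b := n)) fun ξ hξ => ?_
  refine triangle_eq_zero hn ?_
  by_contra! h
  exact hξ (abs_le.mp h.le)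

lemma triangle_of_mem_Icc {n : ℕ} {ξ : ℝ} (h : ξ ∈ Set.Icc (0 : ℝ) n) :
    triangle n ξ = 1 - ξ / n := by
  unfold triangle
  rw [abs_of_nonneg h.1]
  exact max_eq_right (sub_nonneg.mpr (div_le_one_of_le₀ h.2 (h.1.trans h.2)))

lemma fejer_nonneg (n : ℕ) (x : ℝ) : 0 ≤ fejer n x := by
  unfold fejer; split_ifs <;> positivity

lemma fejer_neg (n : ℕ) (x : ℝ) : fejer n (-x) = fejer n x := by
  simp [fejer]

lemma fejer_eq_mul_fejer_one {n : ℕ} (hn : 0 < n) (x : ℝ) :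
    fejer n x = n * fejer 1 (n * x) := by
  have hn' : (n : ℝ) ≠ 0 := by exact_mod_cast hn.ne'
  by_cases hx : x = 0
  · simp [fejer, hx]
  · simp only [fejer, hx, mul_eq_zero, hn', or_self, if_false, Nat.cast_one, mul_one, one_mul,
      ← mul_assoc]
    field_simp

lemma integral_one_sub_div_mul_cos {n : ℕ} (hn : 0 < n) (x : ℝ) :
    ∫ ξ in (0 : ℝ)..n, (1 - ξ / n) * (2 * Real.cos (2 * π * x * ξ)) = fejer n x := by
  have hn' : (n : ℝ) ≠ 0 := by exact_mod_cast hn.ne'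
  by_cases hx : x = 0
  · have hd : ∀ ξ ∈ Set.uIcc (0 : ℝ) n, HasDerivAt (fun ξ : ℝ => 2 * ξ - ξ ^ 2 / n)
        ((1 - ξ / n) * (2 * Real.cos (2 * π * x * ξ))) ξ := by
      intro ξ _
      refine (((hasDerivAt_id ξ).const_mul 2).sub
        (((hasDerivAt_id ξ).pow 2).div_const (n : ℝ))).congr_deriv ?_
      simp [hx]; ring
    rw [intervalIntegral.integral_eq_sub_of_hasDerivAt hd
      (Continuous.intervalIntegrable (by fun_prop) _ _)]
    simp only [fejer, hx, if_true]
    field_simp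
    ring
  · have ha : 2 * π * x ≠ 0 := by positivity
    have hd : ∀ ξ ∈ Set.uIcc (0 : ℝ) n, HasDerivAt (fun ξ : ℝ =>
        2 * ((1 - ξ / n) * (Real.sin (2 * π * x * ξ) / (2 * π * x))
          - Real.cos (2 * π * x * ξ) / (n * (2 * π * x) ^ 2)))
        ((1 - ξ / n) * (2 * Real.cos (2 * π * x * ξ))) ξ := by
      intro ξ _
      have h0 : HasDerivAt (fun ξ : ℝ => 2 * π * x * ξ) (2 * π * x) ξ := by
        simpa using (hasDerivAt_id ξ).const_mul (2 * π * x)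
      have h1 : HasDerivAt (fun ξ : ℝ => 1 - ξ / n) (-(1 / n)) ξ := by
        simpa using ((hasDerivAt_id ξ).div_const (n : ℝ)).const_sub 1
      refine (((h1.mul (h0.sin.div_const (2 * π * x))).sub
        (h0.cos.div_const (n * (2 * π * x) ^ 2))).const_mul 2).congr_deriv ?_
      field_simp
      ring
    rw [intervalIntegral.integral_eq_sub_of_hasDerivAt hd
      (Continuous.intervalIntegrable (by fun_prop) _ _)]
    simp only [fejer, hx, if_false]
    have hc : Real.cos (2 * π * x * n) = 1 - 2 * Real.sin (π * n * x) ^ 2 := by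
      rw [show 2 * π * x * n = 2 * (π * n * x) by ring, Real.cos_two_mul, Real.cos_sq']
      ring
    simp only [hc, mul_zero, Real.sin_zero, Real.cos_zero, zero_div, sub_zero]
    field_simp
    ring

lemma fourier_triangle {n : ℕ} (hn : 0 < n) (x : ℝ) :
    𝓕 (fun ξ => (triangle n ξ : ℂ)) x = fejer n x := by
  have hn' : (0 : ℝ) < n := by exact_mod_cast hn
  rw [Real.fourier_real_eq_integral_exp_smul]
  set F : ℝ → ℂ := fun ξ => Complex.exp (↑(-2 * π * ξ * x) * Complex.I) • (triangle n ξ : ℂ)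
    with hF
  have hFc : Continuous F := by
    have := continuous_triangle n
    fun_prop
  have hFn : Continuous fun ξ => F (-ξ) := hFc.comp continuous_neg
  have h1 : ∫ ξ, F ξ = ∫ ξ in (-(n : ℝ))..n, F ξ := by
    rw [intervalIntegral.integral_of_le (by linarith),
      setIntegral_eq_integral_of_forall_compl_eq_zero]
    intro ξ hξ
    have : triangle n ξ = 0 := by
      refine triangle_eq_zero hn ?_
      by_contra! h
      exact hξ ⟨(abs_lt.mp h).1, (abs_lt.mp h).2.le⟩
    simp [hF, this]
  have h2 : ∫ ξ in (-(n : ℝ))..0, F ξ = ∫ ξ in (0 : ℝ)..n, F (-ξ) := by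
    simp [intervalIntegral.integral_comp_neg]
  rw [h1, ← intervalIntegral.integral_add_adjacent_intervals (b := 0)
    (hFc.intervalIntegrable _ _) (hFc.intervalIntegrable _ _), h2,
    ← intervalIntegral.integral_add (hFn.intervalIntegrable _ _)
      (hFc.intervalIntegrable _ _),
    ← integral_one_sub_div_mul_cos hn x, ← intervalIntegral.integral_ofReal]
  refine intervalIntegral.integral_congr fun ξ hξ => ?_
  rw [Set.uIcc_of_le hn'.le] at hξ
  simp only [hF, triangle_neg, triangle_of_mem_Icc hξ, smul_eq_mul, ← add_mul]
  push_cast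
  rw [mul_comm, Complex.cos]
  ring_nf

lemma continuous_fejer {n : ℕ} (hn : 0 < n) : Continuous (fejer n) := by
  have h : Continuous (𝓕 (fun ξ => (triangle n ξ : ℂ))) :=
    VectorFourier.fourierIntegral_continuous Real.continuous_fourierChar
      (by fun_prop) (integrable_triangle hn).ofReal
  rw [funext (fourier_triangle hn)] at h
  simpa using! Complex.continuous_re.comp h

lemma integrable_fejer {n : ℕ} (hn : 0 < n) : Integrable (fejer n) := by
  have hn' : (0 : ℝ) < n := by exact_mod_cast hn
  refine (integrable_inv_one_add_sq.const_mul ((n : ℝ) + 1)).mono'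
    (continuous_fejer hn).aestronglyMeasurable (Eventually.of_forall fun x => ?_)
  rw [Real.norm_of_nonneg (fejer_nonneg n x), ← div_eq_mul_inv, le_div_iff₀ (by positivity)]
  by_cases hx : x = 0
  · simp [fejer, hx]
  have hx2 : 0 < x ^ 2 := by positivity
  simp only [fejer, hx, if_false]
  have hle : Real.sin (π * n * x) ^ 2 ≤ (π * n * x) ^ 2 := sq_le_sq.mpr Real.abs_sin_le_abs
  have h1 := Real.sin_sq_le_one (π * n * x)
  have hpi : 1 ≤ n * π ^ 2 := by
    have : (1 : ℝ) ≤ n := by exact_mod_cast hn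
    nlinarith [Real.pi_gt_three]
  rw [div_mul_eq_mul_div, div_le_iff₀ (by positivity)]
  nlinarith [mul_le_mul_of_nonneg_right h1 hx2.le, mul_le_mul_of_nonneg_right hpi hx2.le]

lemma integral_fejer {n : ℕ} (hn : 0 < n) : ∫ x, fejer n x = 1 := by
  have hF := funext (fourier_triangle hn)
  have h := congrFun (Continuous.fourierInv_fourier_eq
    (f := fun ξ => (triangle n ξ : ℂ)) (Complex.continuous_ofReal.comp (continuous_triangle n))
    (integrable_triangle hn).ofReal (hF ▸ (integrable_fejer hn).ofReal)) 0
  rw [hF, Real.fourierInv_eq'] at h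
  simp only [inner_zero_right, mul_zero, Complex.ofReal_zero, zero_mul, Complex.exp_zero, one_smul,
    integral_complex_ofReal] at h
  simpa [triangle] using! h

lemma ftransform_schwartz (g : SchwartzMap ℝ ℂ) (ξ : ℝ) : ftransform g ξ = 𝓕 g ξ := by
  rw [SchwartzMap.fourier_coe, Real.fourier_real_eq_integral_exp_smul, ftransform]
  refine integral_congr_ae (Eventually.of_forall fun x => ?_)
  simp only [smul_eq_mul]
  push_cast
  ring_nf

lemma fourier_fourier_schwartz (g : SchwartzMap ℝ ℂ) (ξ : ℝ) : 𝓕 (𝓕 g) ξ = g (-ξ) := by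
  have h : 𝓕⁻ (𝓕 g) (-ξ) = g (-ξ) := by rw [FourierTransform.fourierInv_fourier_eq]
  rw [← h, SchwartzMap.fourierInv_coe, SchwartzMap.fourier_coe (𝓕 g),
    Real.fourierInv_eq_fourier_neg, neg_neg]

lemma fourier_modulated_triangle {n : ℕ} (hn : 0 < n) (s x : ℝ) :
    𝓕 (fun ξ : ℝ => Complex.exp (↑(2 * π * ξ * s) * Complex.I) * (triangle n ξ : ℂ)) x
      = fejer n (x - s) := by
  rw [← fourier_triangle hn, Real.fourier_real_eq_integral_exp_smul,
    Real.fourier_real_eq_integral_exp_smul]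
  refine integral_congr_ae (Eventually.of_forall fun ξ => ?_)
  simp only [smul_eq_mul]
  rw [← mul_assoc, ← Complex.exp_add]
  push_cast
  ring_nf

/-- A translate of the Fejér kernel annihilates the Fourier transform of any Schwartz function
vanishing on `[-n, n]`. -/
lemma integral_fejer_sub_mul_fourier_eq_zero {n : ℕ} (hn : 0 < n) (g : SchwartzMap ℝ ℂ)
    (hg : ∀ ξ ∈ Set.Icc (-(n : ℝ)) n, g ξ = 0) (s : ℝ) :
    ∫ x, (fejer n (x - s) : ℂ) * 𝓕 g x = 0 := by
  set h : ℝ → ℂ := fun ξ => Complex.exp (↑(2 * π * ξ * s) * Complex.I) * (triangle n ξ : ℂ) with hh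
  have hc : Continuous h := by
    have := continuous_triangle n
    fun_prop
  have hi : Integrable h := by
    refine (integrable_triangle hn).mono hc.aestronglyMeasurable (Eventually.of_forall fun ξ => ?_)
    simp only [hh, norm_mul, Complex.norm_exp_ofReal_mul_I, one_mul, Complex.norm_real, le_refl]
  have key := VectorFourier.integral_fourierIntegral_smul_eq_flip (L := innerₗ ℝ)
    Real.continuous_fourierChar continuous_inner hi ((𝓕 g).integrable (μ := volume))
  have key' : ∫ x, 𝓕 h x • 𝓕 g x = ∫ ξ, h ξ • 𝓕 (𝓕 g) ξ := by simpa using! key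
  simp_rw [hh, fourier_modulated_triangle hn, smul_eq_mul] at key'
  rw [key', ← integral_zero ℝ ℂ]
  refine integral_congr_ae (Eventually.of_forall fun ξ => ?_)
  simp only [fourier_fourier_schwartz]
  by_cases hξ : (n : ℝ) ≤ |ξ|
  · simp [triangle_eq_zero hn hξ]
  · rw [hg, mul_zero]
    rw [← abs_neg] at hξ
    exact abs_le.mp (not_le.mp hξ).le

/-- The distributional Fourier support of `u ∗ fejer n` lies in `[-n, n]`. -/
lemma integral_convolution_fejer_mul_fourier_eq_zero {n : ℕ} (hn : 0 < n) {u : ℝ → ℝ}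
    (hu : Continuous u) (hb : ∀ t, |u t| ≤ 1) (g : SchwartzMap ℝ ℂ)
    (hg : ∀ ξ ∈ Set.Icc (-(n : ℝ)) n, g ξ = 0) :
    ∫ x, ((∫ t, u (x - t) * fejer n t : ℝ) : ℂ) * 𝓕 g x = 0 := by
  have hint : Integrable (fun p : ℝ × ℝ => (u p.2 : ℂ) * ((fejer n (p.1 - p.2) : ℂ) * 𝓕 g p.1))
      (volume.prod volume) := by
    refine Integrable.bdd_mul (c := 1) ?_
      (Continuous.aestronglyMeasurable (by fun_prop)) (Eventually.of_forall fun p => ?_)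
    · have h := ((𝓕 g).integrable (μ := volume)).convolution_integrand
        (ContinuousLinearMap.mul ℝ ℂ) (integrable_fejer hn).ofReal (μ := volume)
      refine h.swap.congr (Eventually.of_forall fun p => ?_)
      simp only [Function.comp_apply, Prod.swap, ContinuousLinearMap.mul_apply']
      rw [mul_comm, ← fejer_neg, neg_sub]
      rfl
    · simpa using! hb p.2
  calc ∫ x, ((∫ t, u (x - t) * fejer n t : ℝ) : ℂ) * 𝓕 g x
      = ∫ x, ∫ s, (u s : ℂ) * ((fejer n (x - s) : ℂ) * 𝓕 g x) := by
        refine integral_congr_ae (Eventually.of_forall fun x => ?_)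
        simp only
        rw [← integral_sub_left_eq_self (fun t => u (x - t) * fejer n t) volume x,
          ← integral_complex_ofReal, ← integral_mul_const]
        simp only [sub_sub_cancel]
        push_cast
        simp only [mul_assoc]
    _ = ∫ s, ∫ x, (u s : ℂ) * ((fejer n (x - s) : ℂ) * 𝓕 g x) := integral_integral_swap hint
    _ = 0 := by
        simp_rw [integral_const_mul, integral_fejer_sub_mul_fourier_eq_zero hn g hg, mul_zero,
          integral_zero]

lemma abs_integral_mul_fejer_le_one {n : ℕ} (hn : 0 < n) {u : ℝ → ℝ} (hb : ∀ t, |u t| ≤ 1) :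
    |∫ t, u t * fejer n t| ≤ 1 := by
  rw [← integral_fejer hn, ← Real.norm_eq_abs]
  refine norm_integral_le_of_norm_le (integrable_fejer hn) (Eventually.of_forall fun t => ?_)
  rw [norm_mul, Real.norm_of_nonneg (fejer_nonneg n t)]
  exact mul_le_of_le_one_left (fejer_nonneg n t) (hb t)

/-- The Fejér kernels form an approximate identity on bounded continuous functions. -/
lemma tendsto_integral_mul_fejer {u : ℝ → ℝ} (hu : Continuous u) (hb : ∀ t, |u t| ≤ 1) (x : ℝ) :
    Tendsto (fun n : ℕ => ∫ t, u (x - t) * fejer (n + 1) t) atTop (𝓝 (u x)) := by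
  have hscale (n : ℕ) : ∫ t, u (x - t) * fejer (n + 1) t
      = ∫ t, u (x - t / ((n + 1 : ℕ) : ℝ)) * fejer 1 t := by
    have hn : (0 : ℝ) < ((n + 1 : ℕ) : ℝ) := by positivity
    have h := Measure.integral_comp_mul_left
      (fun t => u (x - t / ((n + 1 : ℕ) : ℝ)) * fejer 1 t) ((n + 1 : ℕ) : ℝ)
    rw [abs_of_pos (inv_pos.mpr hn), smul_eq_mul, eq_inv_mul_iff_mul_eq₀ hn.ne',
      ← integral_const_mul] at h
    rw [← h]
    refine integral_congr_ae (Eventually.of_forall fun t => ?_)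
    simp only
    rw [fejer_eq_mul_fejer_one n.succ_pos, mul_div_cancel_left₀ _ hn.ne']
    ring
  simp_rw [hscale]
  have hlim : u x = ∫ t, u x * fejer 1 t := by
    rw [integral_const_mul, integral_fejer one_pos, mul_one]
  rw [hlim]
  refine tendsto_integral_of_dominated_convergence (fejer 1)
    (fun n => ((hu.comp (by fun_prop)).mul (continuous_fejer one_pos)).aestronglyMeasurable)
    (integrable_fejer one_pos) (fun n => Eventually.of_forall fun t => ?_)
    (Eventually.of_forall fun t => ?_)
  · rw [norm_mul, Real.norm_of_nonneg (fejer_nonneg 1 t)]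
    exact mul_le_of_le_one_left (fejer_nonneg 1 t) (hb _)
  · refine Tendsto.mul_const _ ((hu.tendsto x).comp ?_)
    have h0 : Tendsto (fun n : ℕ => t / ((n + 1 : ℕ) : ℝ)) atTop (𝓝 0) :=
      (tendsto_add_atTop_iff_nat 1).mpr (tendsto_const_div_atTop_nhds_zero_nat t)
    simpa using h0.const_sub x

lemma continuous_integral_mul_fejer {X : Set C(ℝ, ℕ → ℝ)}
    (hb : ∀ f ∈ X, ∀ (t : ℝ) (i : ℕ), |(f : C(ℝ, ℕ → ℝ)) t i| ≤ 1) {n : ℕ} (hn : 0 < n) (i : ℕ) :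
    Continuous fun p : X × ℝ => ∫ t, (p.1 : C(ℝ, ℕ → ℝ)) (p.2 - t) i * fejer n t := by
  refine continuous_of_dominated (bound := fejer n) (fun p => ?_)
    (fun p => Eventually.of_forall fun t => ?_) (integrable_fejer hn)
    (Eventually.of_forall fun t => ?_)
  · have := continuous_fejer hn
    exact Continuous.aestronglyMeasurable (by fun_prop)
  · rw [norm_mul, Real.norm_of_nonneg (fejer_nonneg n t)]
    exact mul_le_of_le_one_left (fejer_nonneg n t) (hb _ p.1.2 _ _)
  · fun_prop

/-- Any shift-invariant compact subset `X` of `C(ℝ, [0,1]^ℕ)` embeds equivariantly,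
via `G(f)(n, i) = f_i ∗ φ_{n+1}`, into the product `∏_{n,i} B_1 V_{-(n+1)}^{n+1}`:
`G` is injective, continuous, a homeomorphism onto its image, equivariant, and each
component is bounded by `1` with distributional Fourier support in `[-(n+1), n+1]`. -/
theorem fejer_convolution_embedding (X : Set C(ℝ, ℕ → ℝ)) (hX : IsCompact X)
    (hval : ∀ f ∈ X, ∀ (t : ℝ) (i : ℕ), (f : C(ℝ, ℕ → ℝ)) t i ∈ Set.Icc (0 : ℝ) 1)
    (hinv : ∀ (r : ℝ), ∀ f ∈ X, tau r f ∈ X) :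
    ∃ G : X → (ℕ × ℕ → C(ℝ, ℝ)),
      (∀ (f : X) (n i : ℕ) (x : ℝ),
        G f (n, i) x = ∫ t : ℝ, (f : C(ℝ, ℕ → ℝ)) (x - t) i * fejer (n + 1) t) ∧
      Function.Injective G ∧
      Continuous G ∧
      IsEmbedding G ∧
      (∀ (r : ℝ) (f : X) (n i : ℕ),
        G ⟨tau r (f : C(ℝ, ℕ → ℝ)), hinv r f f.2⟩ (n, i) = tau r (G f (n, i))) ∧
      (∀ (f : X) (n i : ℕ) (x : ℝ), |G f (n, i) x| ≤ 1) ∧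
      (∀ (f : X) (n i : ℕ) (g : SchwartzMap ℝ ℂ),
        (∀ ξ ∈ Set.Icc (-(n + 1 : ℝ)) (n + 1 : ℝ), g ξ = 0) →
        ∫ x : ℝ, ((G f (n, i) x : ℝ) : ℂ) * ftransform g x = 0) := by
  have hb : ∀ f ∈ X, ∀ (t : ℝ) (i : ℕ), |(f : C(ℝ, ℕ → ℝ)) t i| ≤ 1 := fun f hf t i =>
    abs_le.mpr ⟨by linarith [(hval f hf t i).1], (hval f hf t i).2⟩
  let H (n i : ℕ) : C(X × ℝ, ℝ) :=
    ⟨_, continuous_integral_mul_fejer hb n.succ_pos i⟩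
  let G : X → (ℕ × ℕ → C(ℝ, ℝ)) := fun f p => (H p.1 p.2).curry f
  have hG (f : X) (n i : ℕ) (x : ℝ) :
      G f (n, i) x = ∫ t : ℝ, (f : C(ℝ, ℕ → ℝ)) (x - t) i * fejer (n + 1) t := rfl
  have hu (f : X) (i : ℕ) : Continuous fun t => (f : C(ℝ, ℕ → ℝ)) t i := by fun_prop
  have hcont : Continuous G := continuous_pi fun p => (H p.1 p.2).curry.continuous
  have hinj : Function.Injective G := by
    intro f f' h
    ext x i
    refine tendsto_nhds_unique (tendsto_integral_mul_fejer (hu f i) (hb f f.2 · i) x) ?_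
    simpa only [← hG, h] using tendsto_integral_mul_fejer (hu f' i) (hb f' f'.2 · i) x
  have : CompactSpace X := isCompact_iff_compactSpace.mp hX
  refine ⟨G, hG, hinj, hcont, (hcont.isClosedEmbedding hinj).isEmbedding, ?_, ?_, ?_⟩
  · intro r f n i
    ext x
    simp only [tau, ContinuousMap.comp_apply, ContinuousMap.coe_mk, hG]
    simp only [sub_add_eq_add_sub]
  · intro f n i x
    rw [hG]
    exact abs_integral_mul_fejer_le_one n.succ_pos fun t => hb f f.2 (x - t) i
  · intro f n i g hg
    simp_rw [hG, ftransform_schwartz]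
    exact integral_convolution_fejer_mul_fourier_eq_zero n.succ_pos (hu f i) (hb f f.2 · i) g
      (by simpa using hg)
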